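/- Three-triggered-stabilizers case of the proof of Theorem 2: let m ≥ 5. For every fault pattern F with w(F) ≤ 2 whose observed syndrome has exactly three triggered bits (|supp s(F)| = 3), the data error satisfies wt(e(F)) ≤ w(F); hence applying no correction is safe when three cat stabilizers are triggered. -/

import Mathlib

open scoped Classical

namespace CutCat

/-- A fault in the cut-cat single-round fault model, located at cat qubit `r`. -/
inductive Fault (m : ℕ) where
  | pre  (r : ZMod m)
  | mid  (r : ZMod m)
  | post (r : ZMod m)
  | meas (r : ZMod m)

variable {m : ℕ}

/-- The index (in `ZMod (2*m)`) of the data qubit `2r` coupled to cat qubit `r`. -/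
def d0 (r : ZMod m) : ZMod (2 * m) := 2 * (r.val : ZMod (2 * m))

/-- The data-qubit error contributed by a single fault. -/
def Fault.dataErr : Fault m → ZMod (2 * m) → ZMod 2
  | .pre r  => fun q => (if q = d0 r then 1 else 0) + (if q = d0 r + 1 then 1 else 0)
  | .mid r  => fun q => if q = d0 r + 1 then 1 else 0
  | .post _ => 0
  | .meas _ => 0

/-- The cat-stabilizer syndrome contribution of a single fault
    (syndrome bit `j` checks cat qubits `j` and `j+1`). -/
def Fault.syn : Fault m → ZMod m → ZMod 2
  | .pre r  => fun j => (if j = r - 1 then 1 else 0) + (if j = r then 1 else 0)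
  | .mid r  => fun j => (if j = r - 1 then 1 else 0) + (if j = r then 1 else 0)
  | .post r => fun j => (if j = r - 1 then 1 else 0) + (if j = r then 1 else 0)
  | .meas r => fun j => if j = r then 1 else 0

/-- The data error `e(F)` of a fault pattern `F` (coordinatewise mod-2 sum). -/
def dataErr (F : Multiset (Fault m)) : ZMod (2 * m) → ZMod 2 :=
  (F.map Fault.dataErr).sum

/-- The observed syndrome `s(F)` of a fault pattern `F` (coordinatewise mod-2 sum). -/
def synd (F : Multiset (Fault m)) : ZMod m → ZMod 2 :=
  (F.map Fault.syn).sum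

/-- Hamming weight of a binary vector. -/
noncomputable def wt {n : ℕ} (f : ZMod n → ZMod 2) : ℕ := {i | f i ≠ 0}.ncard

/-- The set of triggered syndrome bits, `supp s(F)`. -/
def suppSyn (F : Multiset (Fault m)) : Set (ZMod m) := {j | synd F j = 1}

/-- Boundary of a set of cat qubits: checks `j` with exactly one of `j`, `j+1` in `E`. -/
def boundary (E : Set (ZMod m)) : Set (ZMod m) := {j | Xor' (j ∈ E) (j + 1 ∈ E)}

/-- Indicator (as a binary data vector) of the set `{2r+1 : r ∈ E}`. -/
noncomputable def indicOdd (E : Set (ZMod m)) : ZMod (2 * m) → ZMod 2 :=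
  fun q => if ∃ r ∈ E, q = d0 r + 1 then 1 else 0

/-- Indicator of a single data position `j`. -/
def indic {n : ℕ} (j : ZMod n) : ZMod n → ZMod 2 := fun q => if q = j then 1 else 0

/-- `c` is the correction output by the minimum-weight decoder with parameter `t`
    on syndrome `s(F)`: if there is a set `E` of at most `t` cat qubits whose
    boundary equals `supp s(F)`, then `c` is the indicator of `{2r+1 : r ∈ E}`;
    otherwise `c = 0`. -/
def IsDecoderCorrection (t : ℕ) (F : Multiset (Fault m)) (c : ZMod (2 * m) → ZMod 2) : Prop :=
  (∃ E : Set (ZMod m), E.ncard ≤ t ∧ boundary E = suppSyn F ∧ c = indicOdd E) ∨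
  ((¬ ∃ E : Set (ZMod m), E.ncard ≤ t ∧ boundary E = suppSyn F) ∧ c = 0)

/-- `true` iff the fault is a measurement fault. -/
def Fault.isMeas : Fault m → Bool
  | .meas _ => true
  | _ => false

end CutCat

namespace CutCat

theorem wt_add_le {n : ℕ} [NeZero n] (f g : ZMod n → ZMod 2) : wt (f + g) ≤ wt f + wt g := by
  refine (Set.ncard_le_ncard ?_ (Set.toFinite _)).trans (Set.ncard_union_le _ _)
  intro i hi
  by_contra h
  simp only [Set.mem_union, Set.mem_ofPred_eq, not_or, not_not] at h
  exact hi (by simp [h.1, h.2])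

theorem wt_zero {n : ℕ} : wt (0 : ZMod n → ZMod 2) = 0 := by
  simp [wt]

theorem Fault.wt_dataErr_le_two {m : ℕ} (f : Fault m) : wt f.dataErr ≤ 2 := by
  have key : ∀ g : ZMod (2 * m) → ZMod 2, ∀ a b : ZMod (2 * m),
      (∀ q, q ≠ a → q ≠ b → g q = 0) → wt g ≤ 2 := by
    intro g a b h
    refine (Set.ncard_le_ncard (t := {a, b}) ?_ (Set.toFinite _)).trans ?_
    · intro q hq
      by_contra hn
      simp only [Set.mem_insert_iff, Set.mem_singleton_iff, not_or] at hn
      exact hq (h q hn.1 hn.2)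
    · simpa using Set.ncard_insert_le a {b}
  cases f with
  | pre r => exact key _ (d0 r) (d0 r + 1) fun q h₀ h₁ => by simp [dataErr, h₀, h₁]
  | mid r => exact key _ (d0 r) (d0 r + 1) fun q h₀ h₁ => by simp [dataErr, h₁]
  | post r => simp [dataErr, wt_zero]
  | meas r => simp [dataErr, wt_zero]

/-- Measurement faults leave the data untouched; any other fault flips at most two data bits. -/
theorem wt_dataErr_le {m : ℕ} [NeZero m] (F : Multiset (Fault m)) :
    wt (dataErr F) ≤ 2 * F.countP (fun f => ¬ f.isMeas = true) := by
  induction F using Multiset.induction_on with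
  | empty => simp [dataErr, wt_zero]
  | cons f F ih =>
    have hcons : dataErr (f ::ₘ F) = f.dataErr + dataErr F := by simp [dataErr]
    have hadd := wt_add_le f.dataErr (dataErr F)
    have hf := f.wt_dataErr_le_two
    rw [hcons, Multiset.countP_cons]
    by_cases h : f.isMeas = true
    · have h₀ : wt f.dataErr = 0 := by
        cases f <;> simp_all [Fault.isMeas, Fault.dataErr, wt_zero]
      rw [if_neg (not_not_intro h)]
      omega
    · rw [if_pos h]
      omega

theorem Fault.sum_syn {m : ℕ} [NeZero m] (f : Fault m) :
    ∑ j, f.syn j = if f.isMeas = true then 1 else 0 := by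
  have h : (1 : ZMod 2) + 1 = 0 := rfl
  cases f <;> simp [syn, isMeas, Finset.sum_add_distrib, h]

theorem sum_synd {m : ℕ} [NeZero m] (F : Multiset (Fault m)) :
    ∑ j, synd F j = (F.countP (fun f => f.isMeas = true) : ZMod 2) := by
  induction F using Multiset.induction_on with
  | empty => simp [synd]
  | cons f F ih =>
    have hcons : synd (f ::ₘ F) = f.syn + synd F := by simp [synd]
    rw [hcons, Multiset.countP_cons]
    simp only [Pi.add_apply, Finset.sum_add_distrib, ih, f.sum_syn]
    push_cast
    ring

/-- The number of triggered syndrome bits has the parity of the number of measurement faults. -/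
theorem natCast_ncard_suppSyn {m : ℕ} [NeZero m] (F : Multiset (Fault m)) :
    ((suppSyn F).ncard : ZMod 2) = (F.countP (fun f => f.isMeas = true) : ZMod 2) := by
  rw [← sum_synd, suppSyn, Set.ncard_eq_toFinset_card', Set.toFinset_ofPred,
    Finset.natCast_card_filter]
  refine Finset.sum_congr rfl fun j _ => ?_
  generalize synd F j = x
  split_ifs with h
  · exact h.symm
  · revert x
    decide

end CutCat

/-- Three-triggered-stabilizers case of the proof of Theorem 2: if `w(F) ≤ 2`
and exactly three cat stabilizers are triggered, then `wt(e(F)) ≤ w(F)`,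
so no correction is needed. -/
theorem cutcat_d5_three_triggered (m : ℕ) (hm : 5 ≤ m)
    (F : Multiset (CutCat.Fault m)) (hF : Multiset.card F ≤ 2)
    (hs : (CutCat.suppSyn F).ncard = 3) :
    CutCat.wt (CutCat.dataErr F) ≤ Multiset.card F := by
  have : NeZero m := ⟨by omega⟩
  have hparity := CutCat.natCast_ncard_suppSyn F
  rw [hs, ZMod.natCast_eq_natCast_iff'] at hparity
  have hwt := CutCat.wt_dataErr_le F
  have hcard := F.card_eq_countP_add_countP (fun f => f.isMeas = true)
  omega
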